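/- For any two Borel probability measures μ, ν on a complete separable metric space with finite Kantorovich distance, there exist random variables ξ, ξ₀ on some probability space with 𝒟(ξ) = μ, 𝒟(ξ₀) = ν and E d(ξ, ξ₀) = ‖μ − ν‖_K (Kantorovich–Rubinstein duality: the Wasserstein-1 distance is attained by an optimal coupling and equals the Lipschitz dual norm). -/

import Mathlib

open MeasureTheory ENNReal

/-- The Kantorovich (Wasserstein-1) distance in its dual form:
the supremum of `∫ f dμ - ∫ f dν` over 1-Lipschitz `f`. -/
noncomputable def kant {M : Type*} [MetricSpace M] [MeasurableSpace M]
    (μ ν : Measure M) : ℝ :=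
  sSup {r | ∃ f : M → ℝ, (∀ x y, |f x - f y| ≤ dist x y) ∧
    r = (∫ x, f x ∂μ) - ∫ x, f x ∂ν}

lemma kant_int {M : Type*} [MetricSpace M] [TopologicalSpace.SeparableSpace M] [MeasurableSpace M] [BorelSpace M]
    (μ : Measure M) [IsProbabilityMeasure μ] (x₀ : M) (h₁ : ∫⁻ x, edist x x₀ ∂μ < ⊤) :
    Integrable (fun x => dist x x₀) μ := by
  refine ⟨(continuous_id.dist continuous_const).aestronglyMeasurable, ?_⟩
  have : ∀ x, ‖dist x x₀‖ₑ = edist x x₀ := fun x => by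
    rw [Real.enorm_of_nonneg dist_nonneg, edist_dist]
  simpa only [HasFiniteIntegral, this] using h₁

lemma kant_lip {M : Type*} [MetricSpace M] [TopologicalSpace.SeparableSpace M] [MeasurableSpace M] [BorelSpace M]
    (μ : Measure M) [IsProbabilityMeasure μ] (x₀ : M) (h₁ : Integrable (fun x => dist x x₀) μ)
    (f : M → ℝ) (t : ℝ) (hf : ∀ x y, |f x - f y| ≤ t * dist x y) : Integrable f μ := by
  have hc : Continuous f := by
    refine (LipschitzWith.of_dist_le_mul (K := t.toNNReal) ?_).continuous
    intro x y
    rw [Real.dist_eq]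
    exact (hf x y).trans (mul_le_mul_of_nonneg_right (Real.le_coe_toNNReal t) dist_nonneg)
  have : Integrable (fun x => f x - f x₀) μ := by
    refine (h₁.const_mul t).mono' (by fun_prop) (.of_forall fun x => ?_)
    exact hf x x₀
  have h2 := this.add (integrable_const (f x₀))
  exact h2.congr (.of_forall fun x => by simp)

lemma kant_le {M : Type*} [MetricSpace M] [TopologicalSpace.SeparableSpace M] [MeasurableSpace M] [BorelSpace M]
    (μ ν : Measure M) [IsProbabilityMeasure μ] [IsProbabilityMeasure ν] (x₀ : M)
    (h₁ : Integrable (fun x => dist x x₀) μ) (h₂ : Integrable (fun x => dist x x₀) ν)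
    (f : M → ℝ) (hf : ∀ x y, |f x - f y| ≤ dist x y) :
    (∫ x, f x ∂μ) - ∫ x, f x ∂ν ≤ kant μ ν := by
  refine le_csSup ⟨(∫ x, dist x x₀ ∂μ) + ∫ x, dist x x₀ ∂ν, ?_⟩ ⟨f, hf, rfl⟩
  rintro _ ⟨g, hg, rfl⟩
  have i1 := kant_lip μ x₀ h₁ g 1 (by simpa using hg)
  have i2 := kant_lip ν x₀ h₂ g 1 (by simpa using hg)
  have e1 : ∫ x, g x ∂μ ≤ ∫ x, (g x₀ + dist x x₀) ∂μ :=
    integral_mono i1 ((integrable_const _).add h₁) fun x => by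
      have := (abs_le.1 (hg x x₀)).2; simp only; linarith
  have e2 : ∫ x, (g x₀ - dist x x₀) ∂ν ≤ ∫ x, g x ∂ν :=
    integral_mono ((integrable_const _).sub h₂) i2 fun x => by
      have := (abs_le.1 (hg x x₀)).1; simp only; linarith
  rw [integral_add (integrable_const _) h₁] at e1
  rw [integral_sub (integrable_const _) h₂] at e2
  simp at e1 e2
  linarith

lemma kant_dual {M : Type*} [MetricSpace M] [TopologicalSpace.SeparableSpace M] [MeasurableSpace M] [BorelSpace M]
    (μ ν : Measure M) [IsProbabilityMeasure μ] [IsProbabilityMeasure ν] (x₀ : M)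
    (h₁ : Integrable (fun x => dist x x₀) μ) (h₂ : Integrable (fun x => dist x x₀) ν)
    (φ ψ : M → ℝ) (hφ : Integrable φ μ) (hψ : Integrable ψ ν) (t C : ℝ) (ht : 0 ≤ t)
    (h : ∀ x y, -C ≤ φ x + ψ y + t * dist x y) :
    -C ≤ ∫ x, φ x ∂μ + ∫ x, ψ x ∂ν + t * kant μ ν := by
  have : Nonempty M := ⟨x₀⟩
  let f : M → ℝ := fun x => ⨅ y, (ψ y + t * dist x y)
  have hb : ∀ x, BddBelow (Set.range fun y => ψ y + t * dist x y) := by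
    intro x
    refine ⟨-C - φ x, ?_⟩
    rintro _ ⟨y, rfl⟩
    have := h x y
    simp only; linarith
  have f1 : ∀ x, -C - φ x ≤ f x := fun x => le_ciInf fun y => by
    have := h x y
    linarith
  have f2 : ∀ x, f x ≤ ψ x := fun x => (ciInf_le (hb x) x).trans (by simp)
  have f3' : ∀ x y, f x - f y ≤ t * dist x y := by
    intro x y
    have : f x - t * dist x y ≤ f y := le_ciInf fun z => by
      have h1 : f x ≤ ψ z + t * dist x z := ciInf_le (hb x) z
      have h2 := mul_le_mul_of_nonneg_left (dist_triangle x y z) ht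
      linarith
    linarith
  have f3 : ∀ x y, |f x - f y| ≤ t * dist x y := by
    intro x y
    rw [abs_sub_le_iff]
    exact ⟨f3' x y, dist_comm y x ▸ f3' y x⟩
  have i1 := kant_lip μ x₀ h₁ f t f3
  have i2 := kant_lip ν x₀ h₂ f t f3
  have e1 : ∫ x, (-C - φ x) ∂μ ≤ ∫ x, f x ∂μ := integral_mono ((integrable_const _).sub hφ) i1 f1
  have e2 : ∫ x, f x ∂ν ≤ ∫ x, ψ x ∂ν := integral_mono i2 hψ f2
  rw [integral_sub (integrable_const _) hφ] at e1
  simp at e1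
  have e3 : ∫ x, f x ∂μ - ∫ x, f x ∂ν ≤ t * kant μ ν := by
    rcases ht.eq_or_lt with rfl | ht
    · have : ∀ x, f x = f x₀ := fun x => by
        have := f3 x x₀
        simp only [zero_mul] at this
        exact sub_eq_zero.1 (abs_nonpos_iff.1 this)
      simp [this]
    · have := kant_le μ ν x₀ h₁ h₂ (fun x => t⁻¹ * f x) (fun x y => by
        rw [← mul_sub, abs_mul, abs_of_pos (inv_pos.2 ht), inv_mul_le_iff₀ ht]; exact f3 x y)
      rw [integral_const_mul, integral_const_mul, ← mul_sub, inv_mul_le_iff₀ ht] at this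
      exact this
  linarith

lemma kant_coupling {M K : Type*} [MetricSpace M] [TopologicalSpace.SeparableSpace M]
    [MeasurableSpace M] [BorelSpace M]
    [TopologicalSpace K] [CompactSpace K] [T2Space K] [SecondCountableTopology K]
    [MeasurableSpace K] [BorelSpace K]
    (μ ν : Measure M) [IsProbabilityMeasure μ] [IsProbabilityMeasure ν] (x₀ : M)
    (h₁ : Integrable (fun x => dist x x₀) μ) (h₂ : Integrable (fun x => dist x x₀) ν)
    (e : C(M, K)) :
    ∃ π : Measure (K × K), IsFiniteMeasure π ∧
      (∀ φ : C(K, ℝ), ∫ k, φ k.1 ∂π = ∫ x, φ (e x) ∂μ) ∧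
      (∀ φ : C(K, ℝ), ∫ k, φ k.2 ∂π = ∫ x, φ (e x) ∂ν) ∧
      (∀ c : C(K × K, ℝ), (∀ x y, c (e x, e y) ≤ dist x y) → ∫ k, c k ∂π ≤ kant μ ν) := by
  have iφ : ∀ (ρ : Measure M) [IsProbabilityMeasure ρ] (φ : C(K, ℝ)),
      Integrable (fun x => φ (e x)) ρ := by
    intro ρ _ φ
    refine (integrable_const ‖φ‖).mono' (by fun_prop) (.of_forall fun x => φ.norm_coe_le_norm _)
  let S : C(K × K, ℝ) → Set ℝ := fun h => {r | ∃ (φ ψ : C(K, ℝ)) (t : ℝ), 0 ≤ t ∧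
    (∀ x y, h (e x, e y) ≤ φ (e x) + ψ (e y) + t * dist x y) ∧
    r = ∫ x, φ (e x) ∂μ + ∫ x, ψ (e x) ∂ν + t * kant μ ν}
  have Sbdd : ∀ h, BddBelow (S h) := by
    intro h
    refine ⟨-‖h‖, ?_⟩
    rintro _ ⟨φ, ψ, t, ht, H, rfl⟩
    refine kant_dual μ ν x₀ h₁ h₂ _ _ (iφ _ _) (iφ _ _) t _ ht fun x y => ?_
    exact (neg_le_of_abs_le (h.norm_coe_le_norm _)).trans (H x y)
  have Sne : ∀ h, (S h).Nonempty := by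
    intro h
    refine ⟨_, ContinuousMap.const _ ‖h‖, 0, 0, le_rfl, fun x y => ?_, rfl⟩
    simpa using (le_abs_self _).trans (h.norm_coe_le_norm (e x, e y))
  have Nhom' : ∀ c : ℝ, 0 < c → ∀ h, sInf (S (c • h)) ≤ c * sInf (S h) := by
    intro c hc h
    rw [← inv_mul_le_iff₀ hc]
    refine le_csInf (Sne h) ?_
    rintro _ ⟨φ, ψ, t, ht, H, rfl⟩
    rw [inv_mul_le_iff₀ hc]
    refine csInf_le (Sbdd _) ⟨c • φ, c • ψ, c * t, by positivity, fun x y => ?_, ?_⟩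
    · have := mul_le_mul_of_nonneg_left (H x y) hc.le
      simp only [ContinuousMap.smul_apply, smul_eq_mul]
      linarith
    · simp only [ContinuousMap.smul_apply, smul_eq_mul, integral_const_mul]
      ring
  obtain ⟨L, -, hL⟩ := exists_extension_of_le_sublinear (⊥ : C(K × K, ℝ) →ₗ.[ℝ] ℝ)
    (fun h => sInf (S h)) (by
      intro c hc h
      refine le_antisymm (Nhom' c hc h) ?_
      have := Nhom' c⁻¹ (inv_pos.2 hc) (c • h)
      rw [smul_smul, inv_mul_cancel₀ hc.ne', one_smul, le_inv_mul_iff₀ hc] at this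
      exact this) (by
      intro h k
      rw [← sub_le_iff_le_add]
      refine le_csInf (Sne h) ?_
      rintro _ ⟨φ, ψ, t, ht, H, rfl⟩
      rw [sub_le_comm]
      refine le_csInf (Sne k) ?_
      rintro _ ⟨φ', ψ', t', ht', H', rfl⟩
      rw [sub_le_iff_le_add]
      refine csInf_le (Sbdd _) ⟨φ + φ', ψ + ψ', t + t', by positivity, fun x y => ?_, ?_⟩
      · have := H x y
        have := H' x y
        simp only [ContinuousMap.add_apply]
        linarith
      · simp only [ContinuousMap.add_apply]
        rw [integral_add (iφ _ _) (iφ _ _), integral_add (iφ _ _) (iφ _ _)]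
        ring) (by
      rintro ⟨x, hx⟩
      have hx0 : x = 0 := (Submodule.mem_bot ℝ).1 hx
      subst hx0
      have : (⊥ : C(K × K, ℝ) →ₗ.[ℝ] ℝ) ⟨0, hx⟩ = 0 := LinearPMap.map_zero _
      rw [this]
      refine le_csInf (Sne _) ?_
      rintro _ ⟨φ, ψ, t, ht, H, rfl⟩
      have := kant_dual μ ν x₀ h₁ h₂ _ _ (iφ _ _) (iφ _ _) t 0 ht
        (fun x y => by simpa using H x y)
      simpa using this)
  have hL' : ∀ (h : C(K × K, ℝ)) (φ ψ : C(K, ℝ)) (t : ℝ), 0 ≤ t →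
    (∀ x y, h (e x, e y) ≤ φ (e x) + ψ (e y) + t * dist x y) →
    L h ≤ ∫ x, φ (e x) ∂μ + ∫ x, ψ (e x) ∂ν + t * kant μ ν := fun h φ ψ t ht H =>
      (hL h).trans (csInf_le (Sbdd _) ⟨φ, ψ, t, ht, H, rfl⟩)
  let T : CompactlySupportedContinuousMap (K × K) ℝ →ₗ[ℝ] ℝ :=
    { toFun := fun h => L h.toContinuousMap
      map_add' := fun a b => by rw [← L.map_add]; rfl
      map_smul' := fun a b => by rw [RingHom.id_apply, ← L.map_smul]; rfl }
  let Λ := PositiveLinearMap.mk₀ T (by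
    intro h hh
    have := hL' (-h.toContinuousMap) 0 0 0 le_rfl (fun x y => by
      have : 0 ≤ h (e x, e y) := hh _
      simpa using this)
    simp at this
    exact this)
  have key : ∀ h : C(K × K, ℝ), ∫ k, h k ∂(RealRMK.rieszMeasure Λ) = L h := fun h =>
    RealRMK.integral_rieszMeasure Λ (CompactlySupportedContinuousMap.continuousMapEquiv h)
  refine ⟨RealRMK.rieszMeasure Λ, inferInstance, fun φ => ?_, fun φ => ?_, fun c hc => ?_⟩
  · have a := hL' (φ.comp ⟨Prod.fst, continuous_fst⟩) φ 0 0 le_rfl (by simp)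
    have b := hL' (-φ.comp ⟨Prod.fst, continuous_fst⟩) (-φ) 0 0 le_rfl (by simp)
    have k := key (φ.comp ⟨Prod.fst, continuous_fst⟩)
    simp [integral_neg] at a b k
    linarith
  · have a := hL' (φ.comp ⟨Prod.snd, continuous_snd⟩) 0 φ 0 le_rfl (by simp)
    have b := hL' (-φ.comp ⟨Prod.snd, continuous_snd⟩) 0 (-φ) 0 le_rfl (by simp)
    have k := key (φ.comp ⟨Prod.snd, continuous_snd⟩)
    simp [integral_neg] at a b k
    linarith
  · rw [key]
    simpa using hL' c 0 0 1 zero_le_one (by simpa using hc)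

lemma kant_marginal {K M : Type*} [TopologicalSpace K] [CompactSpace K] [T2Space K]
    [SecondCountableTopology K] [MeasurableSpace K] [BorelSpace K]
    [MeasurableSpace M] (π : Measure (K × K)) [IsFiniteMeasure π] (μ : Measure M)
    [IsProbabilityMeasure μ] (e : M → K) (he : Measurable e) (p : K × K → K) (hp : Measurable p)
    (h : ∀ φ : C(K, ℝ), ∫ k, φ (p k) ∂π = ∫ x, φ (e x) ∂μ) : π.map p = μ.map e := by
  let _ := TopologicalSpace.metrizableSpaceMetric K
  apply ext_of_forall_integral_eq_of_IsFiniteMeasure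
  intro f
  rw [integral_map hp.aemeasurable (by fun_prop), integral_map he.aemeasurable (by fun_prop)]
  exact h f.toContinuousMap

lemma kant_embed (M : Type) [MetricSpace M] [TopologicalSpace.SeparableSpace M] [Nonempty M] :
    ∃ (e : C(M, (i : ℕ) → Set.Icc (0 : ℝ) i.unpair.2)),
      (∀ x y i, |(e x i : ℝ) - e y i| ≤ dist x y) ∧
      ∀ x y, ∀ r < dist x y, ∃ i, r < |(e x i : ℝ) - e y i| := by
  let z := TopologicalSpace.denseSeq M
  refine ⟨⟨fun x i => ⟨min (dist x (z i.unpair.1)) i.unpair.2,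
    le_min dist_nonneg (Nat.cast_nonneg _), min_le_right _ _⟩, by fun_prop⟩, ?_, ?_⟩
  · intro x y i
    refine (abs_min_sub_min_le_max _ _ _ _).trans ?_
    simpa using abs_dist_sub_le x y _
  · intro x y r hr
    obtain ⟨n, hn⟩ := (TopologicalSpace.denseRange_denseSeq M).exists_dist_lt y
      (ε := (dist x y - r) / 2) (by linarith)
    obtain ⟨m, hm⟩ := exists_nat_ge (max (dist x (z n)) (dist y (z n)))
    refine ⟨Nat.pair n m, ?_⟩
    simp only [ContinuousMap.coe_mk, Nat.unpair_pair]
    rw [min_eq_left ((le_max_left _ _).trans hm), min_eq_left ((le_max_right _ _).trans hm)]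
    refine lt_of_lt_of_le ?_ (le_abs_self _)
    have h1 := dist_triangle_right x y (z n)
    change dist y (z n) < _ at hn
    linarith

/-- Kantorovich–Rubinstein duality: for any two Borel probability measures with finite
first moments on a complete separable metric space, there is an optimal coupling, i.e.
random variables `ξ, ξ₀` on some probability space with `𝒟(ξ) = μ`, `𝒟(ξ₀) = ν` and
`E d(ξ, ξ₀) = ‖μ - ν‖_K`, the Lipschitz dual norm. -/
theorem kantorovich_rubinstein (M : Type) [MetricSpace M] [CompleteSpace M]
    [TopologicalSpace.SeparableSpace M] [MeasurableSpace M] [BorelSpace M]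
    (μ ν : Measure M) [IsProbabilityMeasure μ] [IsProbabilityMeasure ν]
    (x₀ : M) (h₁ : ∫⁻ x, edist x x₀ ∂μ < ⊤) (h₂ : ∫⁻ x, edist x x₀ ∂ν < ⊤) :
    ∃ (Ω : Type) (_ : MeasurableSpace Ω) (P : Measure Ω), IsProbabilityMeasure P ∧
      ∃ ξ ξ₀ : Ω → M, Measurable ξ ∧ Measurable ξ₀ ∧
        P.map ξ = μ ∧ P.map ξ₀ = ν ∧
        (∫ ω, dist (ξ ω) (ξ₀ ω) ∂P) = kant μ ν := by
  have : Nonempty M := ⟨x₀⟩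
  have i₁ := kant_int μ x₀ h₁
  have i₂ := kant_int ν x₀ h₂
  obtain ⟨e, e1, e2⟩ := kant_embed M
  have einj : Function.Injective e := by
    intro x y hxy
    by_contra hne
    obtain ⟨i, hi⟩ := e2 x y 0 (dist_pos.2 hne)
    simp [hxy] at hi
  have : PolishSpace M := inferInstance
  have eme : MeasurableEmbedding e := e.continuous.measurableEmbedding einj
  obtain ⟨g, gm, hg⟩ := eme.exists_measurable_extend measurable_id (fun _ => ⟨x₀⟩)
  have hg' : ∀ x, g (e x) = x := fun x => congrFun hg x
  obtain ⟨π, hπ, m1, m2, hc⟩ := kant_coupling μ ν x₀ i₁ i₂ e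
  have M1 := kant_marginal π μ e eme.measurable Prod.fst measurable_fst m1
  have M2 := kant_marginal π ν e eme.measurable Prod.snd measurable_snd m2
  have P1 : π.map (fun k => g k.1) = μ := by
    have := congrArg (Measure.map g) M1
    rw [Measure.map_map gm measurable_fst, Measure.map_map gm eme.measurable, hg,
      Measure.map_id] at this
    exact this
  have P2 : π.map (fun k => g k.2) = ν := by
    have := congrArg (Measure.map g) M2
    rw [Measure.map_map gm measurable_snd, Measure.map_map gm eme.measurable, hg,
      Measure.map_id] at this
    exact this
  have gm1 : Measurable (fun k : ((i : ℕ) → Set.Icc (0 : ℝ) i.unpair.2) ×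
    ((i : ℕ) → Set.Icc (0 : ℝ) i.unpair.2) => g k.1) := gm.comp measurable_fst
  have gm2 : Measurable (fun k : ((i : ℕ) → Set.Icc (0 : ℝ) i.unpair.2) ×
    ((i : ℕ) → Set.Icc (0 : ℝ) i.unpair.2) => g k.2) := gm.comp measurable_snd
  have A1 : ∀ᵐ k ∂π, k.1 ∈ Set.range e := by
    refine ae_of_ae_map measurable_fst.aemeasurable (p := fun k => k ∈ Set.range e) ?_
    rw [M1]
    exact (eme.ae_map_iff).2 (.of_forall fun x => ⟨x, rfl⟩)
  have A2 : ∀ᵐ k ∂π, k.2 ∈ Set.range e := by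
    refine ae_of_ae_map measurable_snd.aemeasurable (p := fun k => k ∈ Set.range e) ?_
    rw [M2]
    exact (eme.ae_map_iff).2 (.of_forall fun x => ⟨x, rfl⟩)
  have prob : IsProbabilityMeasure π := by
    constructor
    have := congrArg (fun ρ => ρ Set.univ) P1
    simpa [Measure.map_apply gm1 MeasurableSet.univ] using this
  refine ⟨_, inferInstance, π, prob, fun k => g k.1, fun k => g k.2, gm1, gm2, P1, P2, ?_⟩
  let a : ℕ → C(((i : ℕ) → Set.Icc (0 : ℝ) i.unpair.2) ×
      ((i : ℕ) → Set.Icc (0 : ℝ) i.unpair.2), ℝ) :=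
    fun i => ⟨fun k => |(k.1 i : ℝ) - k.2 i|, by fun_prop⟩
  let b := partialSups a
  have hb0 : ∀ n k, 0 ≤ b n k := fun n k =>
    (abs_nonneg _).trans (le_partialSups_of_le a (Nat.zero_le n) k)
  have hb1 : ∀ n x y, b n (e x, e y) ≤ dist x y := by
    intro n x y
    induction n with
    | zero =>
      simp only [b, partialSups_zero]
      exact e1 x y 0
    | succ n ih =>
      have : b (n + 1) (e x, e y) = max (b n (e x, e y)) (a (n + 1) (e x, e y)) := by
        simp only [b, partialSups_add_one, ContinuousMap.sup_apply]
      rw [this]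
      exact max_le ih (e1 x y _)
  have hk0 : 0 ≤ kant μ ν := by
    simpa using kant_le μ ν x₀ i₁ i₂ (fun _ => 0) (by simp)
  have hup : ∫⁻ k, ENNReal.ofReal (dist (g k.1) (g k.2)) ∂π ≤ ENNReal.ofReal (kant μ ν) := by
    calc ∫⁻ k, ENNReal.ofReal (dist (g k.1) (g k.2)) ∂π
        ≤ ∫⁻ k, ⨆ n, ENNReal.ofReal (b n k) ∂π := by
          refine lintegral_mono_ae ?_
          filter_upwards [A1, A2] with k hk1 hk2
          obtain ⟨k1, k2⟩ := k
          obtain ⟨x, rfl⟩ := hk1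
          obtain ⟨y, rfl⟩ := hk2
          simp only [hg']
          refine le_of_forall_lt fun r hr => ?_
          have hr' := (ENNReal.lt_ofReal_iff_toReal_lt hr.ne_top).1 hr
          obtain ⟨i, hi⟩ := e2 x y _ hr'
          refine lt_of_lt_of_le ?_ (le_iSup _ i)
          rw [ENNReal.lt_ofReal_iff_toReal_lt hr.ne_top]
          exact hi.trans_le (le_partialSups a i (e x, e y))
      _ = ⨆ n, ∫⁻ k, ENNReal.ofReal (b n k) ∂π :=
          lintegral_iSup (fun n => by fun_prop) (fun n m hnm k =>
            ENNReal.ofReal_le_ofReal (b.monotone hnm k))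
      _ ≤ _ := by
          refine iSup_le fun n => ?_
          rw [← ofReal_integral_eq_lintegral_ofReal _ (.of_forall fun k => hb0 n k)]
          · exact ENNReal.ofReal_le_ofReal (hc (b n) (hb1 n))
          · exact (integrable_const ‖b n‖).mono' (by fun_prop)
              (.of_forall fun x => (b n).norm_coe_le_norm _)
  have gd : Measurable (fun k : ((i : ℕ) → Set.Icc (0 : ℝ) i.unpair.2) ×
    ((i : ℕ) → Set.Icc (0 : ℝ) i.unpair.2) => dist (g k.1) (g k.2)) := gm1.dist gm2
  have hint : Integrable (fun k => dist (g k.1) (g k.2)) π := by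
    refine ⟨gd.aestronglyMeasurable, ?_⟩
    rw [hasFiniteIntegral_iff_ofReal (.of_forall fun k => dist_nonneg)]
    exact hup.trans_lt ENNReal.ofReal_lt_top
  refine le_antisymm ?_ ?_
  · rw [integral_eq_lintegral_of_nonneg_ae (.of_forall fun k => dist_nonneg)
      gd.aestronglyMeasurable]
    exact ENNReal.toReal_le_of_le_ofReal hk0 hup
  · refine csSup_le ⟨_, fun _ => 0, by simp, rfl⟩ ?_
    rintro _ ⟨f, hf, rfl⟩
    have f1 := kant_lip μ x₀ i₁ f 1 (by simpa using hf)
    have f2 := kant_lip ν x₀ i₂ f 1 (by simpa using hf)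
    rw [← P1] at f1
    rw [← P2] at f2
    have q1 : ∫ x, f x ∂μ = ∫ k, f (g k.1) ∂π := by
      rw [← integral_map gm1.aemeasurable f1.1, P1]
    have q2 : ∫ x, f x ∂ν = ∫ k, f (g k.2) ∂π := by
      rw [← integral_map gm2.aemeasurable f2.1, P2]
    have j1 : Integrable (fun k => f (g k.1)) π := f1.comp_measurable gm1
    have j2 : Integrable (fun k => f (g k.2)) π := f2.comp_measurable gm2
    rw [q1, q2, ← integral_sub j1 j2]
    exact integral_mono (j1.sub j2) hint fun k => (le_abs_self _).trans (hf _ _)
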